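/- arXiv:2406.14278 — 9 statements merged into one kernel-verified Lean document; each statement's English description precedes it below -/
import Mathlib

section
/- Let f be a non-negative, symmetric, submodular set function on a finite ground set N, and let S ⊆ N be a set such that f(R) ≤ f(S) for every subset R ⊆ S. Then for every T ⊆ N we have f(S ∪ T) ≥ f(T) − f(S). -/
/-- Let `f` be a non-negative, symmetric, submodular set function on a
finite ground set `N`, and let `S ⊆ N` be a set such that `f R ≤ f S` for every `R ⊆ S`.
Then for every `T ⊆ N`, `f (S ∪ T) ≥ f T − f S`. -/
theorem symmetric_submodular_union_lower_bound
    {N : Type*} [Fintype N] [DecidableEq N] (f : Finset N → ℝ)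
    (hnonneg : ∀ A : Finset N, 0 ≤ f A)
    (hsym : ∀ A : Finset N, f A = f Aᶜ)
    (hsubmod : ∀ A B : Finset N, f (A ∪ B) + f (A ∩ B) ≤ f A + f B)
    (S : Finset N) (hS : ∀ R ⊆ S, f R ≤ f S) :
    ∀ T : Finset N, f (S ∪ T) ≥ f T - f S := by
  intro T
  have hsub := hsubmod (S ∪ T) (S \ T)ᶜ
  have hinter : (S ∪ T) ∩ (S \ T)ᶜ = T := by
    ext x
    simp only [Finset.mem_inter, Finset.mem_union, Finset.mem_compl, Finset.mem_sdiff]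
    tauto
  rw [hinter, ← hsym] at hsub
  have hdiff := hS (S \ T) Finset.sdiff_subset
  have hunion := hnonneg ((S ∪ T) ∪ (S \ T)ᶜ)
  linarith
end

section
/- Let f be a submodular set function on a finite ground set N, let S₀ ⊆ N, and let T_m be the output of the deletion process applied to S₀ with any enumeration v₁,…,v_m of S₀. Then f(R) ≤ f(T_m) for every subset R ⊆ T_m, and moreover f(T_m) ≥ f(S₀). -/
/-- The deletion process: starting from `S₀`, visit the elements of the list `l` in order,
and delete an element whenever its removal does not decrease the value of `f`
(i.e. when `f T − f (T \ {v}) < 0`). -/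
noncomputable def deleteProcess {N : Type*} [DecidableEq N] (f : Finset N → ℝ) (S₀ : Finset N)
    (l : List N) : Finset N :=
  l.foldl (fun T v => if f T - f (T.erase v) < 0 then T.erase v else T) S₀

theorem marginal_le_marginal_of_subset {N : Type*} [DecidableEq N] {f : Finset N → ℝ}
    (hf : ∀ A B : Finset N, f (A ∪ B) + f (A ∩ B) ≤ f A + f B)
    {A T : Finset N} (hAT : A ⊆ T) {v : N} (hv : v ∈ A) :
    f T - f (T.erase v) ≤ f A - f (A.erase v) := by
  have hunion : A ∪ T.erase v = T := by
    ext x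
    by_cases hx : x = v
    · subst hx; simp [hv, hAT hv]
    · simpa [hx] using fun h => hAT h
  have hinter : A ∩ T.erase v = A.erase v := by
    rw [Finset.inter_erase, Finset.inter_eq_left.mpr hAT]
  have h := hf A (T.erase v)
  rw [hunion, hinter] at h
  linarith

theorem deleteProcess_cons {N : Type*} [DecidableEq N] (f : Finset N → ℝ) (T : Finset N)
    (v : N) (l : List N) :
    deleteProcess f T (v :: l) =
      deleteProcess f (if f T - f (T.erase v) < 0 then T.erase v else T) l :=
  rfl

theorem deleteProcess_subset {N : Type*} [DecidableEq N] (f : Finset N → ℝ) (T : Finset N)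
    (l : List N) : deleteProcess f T l ⊆ T := by
  induction l generalizing T with
  | nil => exact subset_rfl
  | cons v l ih =>
    rw [deleteProcess_cons]
    refine (ih _).trans ?_
    split_ifs
    · exact Finset.erase_subset v T
    · exact subset_rfl

theorem le_deleteProcess {N : Type*} [DecidableEq N] (f : Finset N → ℝ) (T : Finset N)
    (l : List N) : f T ≤ f (deleteProcess f T l) := by
  induction l generalizing T with
  | nil => exact le_rfl
  | cons v l ih =>
    rw [deleteProcess_cons]
    refine le_trans ?_ (ih _)
    split_ifs with h
    · linarith
    · exact le_rfl

/-- Every visited element has nonnegative marginal value in every subset of the output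
containing it. -/
theorem erase_le_of_subset_deleteProcess {N : Type*} [DecidableEq N] {f : Finset N → ℝ}
    (hf : ∀ A B : Finset N, f (A ∪ B) + f (A ∩ B) ≤ f A + f B)
    (T : Finset N) {l : List N} {v : N} (hvl : v ∈ l) {A : Finset N}
    (hA : A ⊆ deleteProcess f T l) (hvA : v ∈ A) : f (A.erase v) ≤ f A := by
  induction l generalizing T with
  | nil => simp at hvl
  | cons w l ih =>
    rw [deleteProcess_cons] at hA
    rcases List.mem_cons.mp hvl with rfl | hvl
    · have hAT := hA.trans (deleteProcess_subset f _ l)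
      split_ifs at hAT with h
      · exact absurd (hAT hvA) (Finset.notMem_erase v T)
      · have := marginal_le_marginal_of_subset hf hAT hvA
        linarith
    · exact ih _ hvl hA

theorem le_union_of_erase_le {N : Type*} [DecidableEq N] {f : Finset N → ℝ} {P : Finset N}
    (h : ∀ A ⊆ P, ∀ v ∈ A, f (A.erase v) ≤ f A) {R : Finset N} (hR : R ⊆ P)
    (D : Finset N) (hD : D ⊆ P) : f R ≤ f (R ∪ D) := by
  induction D using Finset.induction_on with
  | empty => simp
  | insert a D _ ih =>
    have hDP : D ⊆ P := (Finset.subset_insert a D).trans hD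
    refine (ih hDP).trans ?_
    rw [Finset.union_insert]
    by_cases ha : a ∈ R ∪ D
    · rw [Finset.insert_eq_of_mem ha]
    · have hins : insert a (R ∪ D) ⊆ P :=
        Finset.insert_subset (hD (Finset.mem_insert_self a D)) (Finset.union_subset hR hDP)
      have := h _ hins a (Finset.mem_insert_self a _)
      rwa [Finset.erase_insert ha] at this

/-- Let `f` be a submodular set function on a finite ground set `N`,
`S₀ ⊆ N`, and let `T_m` be the output of the deletion process applied to `S₀` with any
enumeration `v₁, …, v_m` of `S₀`. Then `f R ≤ f T_m` for every `R ⊆ T_m`, and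
`f T_m ≥ f S₀`. -/
theorem deleteProcess_local_max
    {N : Type*} [Fintype N] [DecidableEq N] (f : Finset N → ℝ)
    (hsubmod : ∀ A B : Finset N, f (A ∪ B) + f (A ∩ B) ≤ f A + f B)
    (S₀ : Finset N) (l : List N) (hnodup : l.Nodup) (henum : l.toFinset = S₀) :
    (∀ R ⊆ deleteProcess f S₀ l, f R ≤ f (deleteProcess f S₀ l)) ∧
      f (deleteProcess f S₀ l) ≥ f S₀ := by
  refine ⟨fun R hR => ?_, le_deleteProcess f S₀ l⟩
  have key := le_union_of_erase_le (f := f) (fun A hA v hv => ?_) hR _ subset_rfl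
  · rwa [Finset.union_eq_right.mpr hR] at key
  · have hvl : v ∈ l := by
      rw [← List.mem_toFinset, henum]
      exact deleteProcess_subset f S₀ l (hA hv)
    exact erase_le_of_subset_deleteProcess hsubmod S₀ hvl hA hv
end

section
/- Let f be a non-negative, symmetric, submodular set function on a finite ground set N, let k ≥ 1 be an integer, and let S ⊆ N satisfy f(R) ≤ f(S) for all R ⊆ S. Let O ⊆ N be any set with |O| ≤ k, and let u* ∈ N be an element maximizing the marginal value f(u | S) over all u ∈ N. Then f(S ∪ {u*}) − f(S) ≥ (1/k)·(f(O) − 2·f(S)). -/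
/-- A bound on the single-element marginals of a submodular function at `S` bounds the marginal
of any set `T` by `T.card` times that bound. -/
theorem submodular_union_le_add_card_mul
    {N : Type*} [DecidableEq N] {f : Finset N → ℝ}
    (hsubmod : ∀ A B : Finset N, f (A ∪ B) + f (A ∩ B) ≤ f A + f B)
    {S : Finset N} {m : ℝ} (hm : ∀ u : N, f (insert u S) - f S ≤ m) (hm0 : 0 ≤ m)
    (T : Finset N) : f (T ∪ S) ≤ f S + T.card * m := by
  induction T using Finset.induction_on with
  | empty => simp
  | insert a T ha ih =>
    rw [Finset.card_insert_of_notMem ha, Finset.insert_union]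
    push_cast
    by_cases haS : a ∈ S
    · rw [Finset.insert_eq_of_mem (Finset.mem_union_right T haS)]
      linarith
    · have h := hsubmod (T ∪ S) (insert a S)
      have hu : (T ∪ S) ∪ insert a S = insert a (T ∪ S) := by grind
      have hi : (T ∪ S) ∩ insert a S = S := by grind
      rw [hu, hi] at h
      linarith [hm a]

/-- Symmetric submodular functions are posimodular. -/
theorem symmetric_submodular_sdiff_add_sdiff_le
    {N : Type*} [Fintype N] [DecidableEq N] {f : Finset N → ℝ}
    (hsym : ∀ A : Finset N, f A = f Aᶜ)
    (hsubmod : ∀ A B : Finset N, f (A ∪ B) + f (A ∩ B) ≤ f A + f B)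
    (A B : Finset N) : f (A \ B) + f (B \ A) ≤ f A + f B := by
  have h := hsubmod A Bᶜ
  have hi : A ∩ Bᶜ = A \ B := by ext; simp
  have hu : (A ∪ Bᶜ)ᶜ = B \ A := by ext; simp [and_comm]
  rw [hsym (A ∪ Bᶜ), hu, hi, ← hsym B] at h
  linarith


/-- Let `f` be a non-negative, symmetric, submodular set function on a
finite ground set `N`, `k ≥ 1` an integer, and `S ⊆ N` with `f R ≤ f S` for all `R ⊆ S`.
Let `O ⊆ N` with `|O| ≤ k` and let `u*` maximize the marginal value `f(u | S)` over all
`u ∈ N`. Then `f (S ∪ {u*}) − f S ≥ (1/k)·(f O − 2·f S)`. -/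
theorem greedy_marginal_gain
    {N : Type*} [Fintype N] [DecidableEq N] (f : Finset N → ℝ)
    (hnonneg : ∀ A : Finset N, 0 ≤ f A)
    (hsym : ∀ A : Finset N, f A = f Aᶜ)
    (hsubmod : ∀ A B : Finset N, f (A ∪ B) + f (A ∩ B) ≤ f A + f B)
    (k : ℕ) (hk : 1 ≤ k)
    (S : Finset N) (hS : ∀ R ⊆ S, f R ≤ f S)
    (O : Finset N) (hO : O.card ≤ k)
    (ustar : N)
    (hustar : ∀ u : N, f (insert u S) - f S ≤ f (insert ustar S) - f S) :
    f (insert ustar S) - f S ≥ (1 / (k : ℝ)) * (f O - 2 * f S) := by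
  have hm0 : 0 ≤ f (insert ustar S) - f S := by
    rcases S.eq_empty_or_nonempty with rfl | ⟨v, hv⟩
    · have h := symmetric_submodular_sdiff_add_sdiff_le hsym hsubmod
        (insert ustar ∅) (insert ustar ∅)
      rw [Finset.sdiff_self] at h
      linarith
    · simpa [Finset.insert_eq_of_mem hv] using hustar v
  have hgain := submodular_union_le_add_card_mul hsubmod hustar hm0 O
  have hpos := symmetric_submodular_sdiff_add_sdiff_le hsym hsubmod (O ∪ S) (S \ O)
  have hl : (O ∪ S) \ (S \ O) = O := by grind
  rw [hl] at hpos
  have hkpos : (0 : ℝ) < k := by exact_mod_cast hk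
  have hcard : (O.card : ℝ) * (f (insert ustar S) - f S) ≤ k * (f (insert ustar S) - f S) :=
    mul_le_mul_of_nonneg_right (by exact_mod_cast hO) hm0
  rw [ge_iff_le, one_div_mul_eq_div, div_le_iff₀ hkpos]
  linarith [hnonneg ((S \ O) \ (O ∪ S)), hS (S \ O) Finset.sdiff_subset]
end

section
/- Let k ≥ 2 be an integer, F ≥ 0 a real number, and (x_i)_{i=0}^{t} a sequence of real numbers with x₀ ≥ 0 such that x_i − x_{i−1} ≥ (1/k)·(F − 2·x_{i−1}) for every i ∈ {1,…,t}. Then x_t ≥ (1/2)·(1 − (1 − 2/k)^t)·F; in particular, taking t = k gives x_k ≥ (1/2)·(1 − e^{−2})·F. -/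
/-- Let `k ≥ 2` be an integer, `F ≥ 0` a real, and `(x_i)_{i=0}^t` a real
sequence with `x₀ ≥ 0` satisfying `x_i − x_{i−1} ≥ (1/k)·(F − 2·x_{i−1})` for `1 ≤ i ≤ t`.
Then `x_t ≥ (1/2)·(1 − (1 − 2/k)^t)·F`; in particular, taking `t = k` gives
`x_k ≥ (1/2)·(1 − e⁻²)·F`. -/
theorem greedy_recursion_cardinality
    (k : ℕ) (hk : 2 ≤ k) (F : ℝ) (hF : 0 ≤ F)
    (t : ℕ) (x : ℕ → ℝ) (hx0 : 0 ≤ x 0)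
    (hrec : ∀ i, 1 ≤ i → i ≤ t → x i - x (i - 1) ≥ (1 / (k : ℝ)) * (F - 2 * x (i - 1))) :
    x t ≥ (1 / 2) * (1 - (1 - 2 / (k : ℝ)) ^ t) * F ∧
      (t = k → x t ≥ (1 / 2) * (1 - Real.exp (-2)) * F) := by
  have hk' : (2 : ℝ) ≤ k := by exact_mod_cast hk
  have hr : 0 ≤ 1 - 2 / (k : ℝ) := sub_nonneg.2 ((div_le_one (by linarith)).2 hk')
  have bound : ∀ i ≤ t, (1 / 2) * (1 - (1 - 2 / (k : ℝ)) ^ i) * F ≤ x i := by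
    intro i
    induction i with
    | zero => intro _; simpa using hx0
    | succ n ih =>
      intro hn
      have step := hrec (n + 1) (by omega) hn
      rw [Nat.add_sub_cancel] at step
      calc (1 / 2) * (1 - (1 - 2 / (k : ℝ)) ^ (n + 1)) * F
          = (1 - 2 / (k : ℝ)) * ((1 / 2) * (1 - (1 - 2 / (k : ℝ)) ^ n) * F)
              + 1 / (k : ℝ) * F := by ring
        _ ≤ (1 - 2 / (k : ℝ)) * x n + 1 / (k : ℝ) * F := by
            gcongr
            exact ih (by omega)
        _ = x n + 1 / (k : ℝ) * (F - 2 * x n) := by ring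
        _ ≤ x (n + 1) := by linarith
  refine ⟨bound t le_rfl, ?_⟩
  rintro rfl
  refine le_trans ?_ (bound t le_rfl)
  gcongr
  exact Real.one_sub_div_pow_le_exp_neg hk'
end

section
/- Let f be a non-negative, symmetric, submodular set function on a finite ground set N, let k ≥ 2 be an integer, and let O ⊆ N satisfy |O| ≤ k. Suppose S₀ = ∅ and for each i ∈ {1,…,k}: (i) u_i ∈ N maximizes f(u | S_{i−1}) over all u ∈ N; (ii) S_i ⊆ S_{i−1} ∪ {u_i}; (iii) f(S_i) ≥ f(S_{i−1} ∪ {u_i}); and (iv) f(R) ≤ f(S_i) for every R ⊆ S_i. Then |S_k| ≤ k and f(S_k) ≥ (1/2)·(1 − (1 − 2/k)^k)·f(O) ≥ (1/2)·(1 − e^{−2})·f(O). -/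
/-- For a submodular function, if no single element raises the value of `A` by more than `d ≥ 0`,
then adding a set `O` raises it by at most `O.card * d`. -/
theorem Finset.submodular_union_sub_le_card_mul {N : Type*} [DecidableEq N] {f : Finset N → ℝ}
    (hsubmod : ∀ A B : Finset N, f (A ∪ B) + f (A ∩ B) ≤ f A + f B)
    {A : Finset N} {d : ℝ} (hd : 0 ≤ d) (hA : ∀ v, f (insert v A) - f A ≤ d) (O : Finset N) :
    f (O ∪ A) - f A ≤ O.card * d := by
  induction O using Finset.induction_on with
  | empty => simp
  | insert v O hv ih =>
    rw [Finset.card_insert_of_notMem hv, Finset.insert_union]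
    push_cast
    by_cases hvA : v ∈ A
    · rw [Finset.insert_eq_of_mem (Finset.mem_union_right O hvA)]
      linarith
    · have h := hsubmod (O ∪ A) (insert v A)
      have hunion : (O ∪ A) ∪ insert v A = insert v (O ∪ A) := by
        grind
      have hinter : (O ∪ A) ∩ insert v A = A := by
        grind
      rw [hunion, hinter] at h
      linarith [hA v]

/-- A symmetric submodular function is minimized by the empty set. -/
theorem Finset.symmetric_submodular_empty_le {N : Type*} [Fintype N] [DecidableEq N]
    {f : Finset N → ℝ} (hsym : ∀ A : Finset N, f A = f Aᶜ)
    (hsubmod : ∀ A B : Finset N, f (A ∪ B) + f (A ∩ B) ≤ f A + f B) (A : Finset N) :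
    f ∅ ≤ f A := by
  have h := hsubmod A Aᶜ
  have huniv := hsym ∅
  rw [Finset.union_compl, Finset.inter_compl, ← hsym A] at h
  rw [Finset.compl_empty] at huniv
  linarith

/-- For a non-negative symmetric submodular function, adding `A` to `O` decreases the value by at
most `f (A \ O)`. -/
theorem Finset.symmetric_submodular_le_union_add_sdiff {N : Type*} [Fintype N] [DecidableEq N]
    {f : Finset N → ℝ} (hnonneg : ∀ A : Finset N, 0 ≤ f A) (hsym : ∀ A : Finset N, f A = f Aᶜ)
    (hsubmod : ∀ A B : Finset N, f (A ∪ B) + f (A ∩ B) ≤ f A + f B) (O A : Finset N) :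
    f O ≤ f (O ∪ A) + f (A \ O) := by
  have h := hsubmod (O ∪ A) (A \ O)ᶜ
  have hinter : (O ∪ A) ∩ (A \ O)ᶜ = O := by
    ext x
    simp only [Finset.mem_inter, Finset.mem_union, Finset.mem_compl, Finset.mem_sdiff]
    tauto
  rw [hinter, ← hsym] at h
  linarith [hnonneg ((O ∪ A) ∪ (A \ O)ᶜ)]


/-- Analysis of the greedy algorithm (with the Delete procedure) for
symmetric submodular maximization under a cardinality constraint `k`. Here, for each round
`i ∈ {1, …, k}`: (i) `u i` maximizes the marginal value with respect to `S (i−1)`;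
(ii) `S i ⊆ S (i−1) ∪ {u i}`; (iii) `f (S i) ≥ f (S (i−1) ∪ {u i})`; and
(iv) `f R ≤ f (S i)` for every `R ⊆ S i`. Then `|S k| ≤ k` and
`f (S k) ≥ (1/2)·(1 − (1 − 2/k)^k)·f O ≥ (1/2)·(1 − e⁻²)·f O`. -/
theorem greedy_cardinality_guarantee
    {N : Type*} [Fintype N] [DecidableEq N] (f : Finset N → ℝ)
    (hnonneg : ∀ A : Finset N, 0 ≤ f A)
    (hsym : ∀ A : Finset N, f A = f Aᶜ)
    (hsubmod : ∀ A B : Finset N, f (A ∪ B) + f (A ∩ B) ≤ f A + f B)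
    (k : ℕ) (hk : 2 ≤ k)
    (O : Finset N) (hO : O.card ≤ k)
    (S : ℕ → Finset N) (u : ℕ → N)
    (hS0 : S 0 = ∅)
    (hgreedy : ∀ i, 1 ≤ i → i ≤ k → ∀ v : N,
      f (insert v (S (i - 1))) - f (S (i - 1)) ≤
        f (insert (u i) (S (i - 1))) - f (S (i - 1)))
    (hsubset : ∀ i, 1 ≤ i → i ≤ k → S i ⊆ insert (u i) (S (i - 1)))
    (hvalue : ∀ i, 1 ≤ i → i ≤ k → f (S i) ≥ f (insert (u i) (S (i - 1))))
    (hdelete : ∀ i, 1 ≤ i → i ≤ k → ∀ R ⊆ S i, f R ≤ f (S i)) :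
    (S k).card ≤ k ∧
      f (S k) ≥ (1 / 2) * (1 - (1 - 2 / (k : ℝ)) ^ k) * f O ∧
      (1 / 2) * (1 - (1 - 2 / (k : ℝ)) ^ k) * f O ≥
        (1 / 2) * (1 - Real.exp (-2)) * f O := by
  have hk0 : (0 : ℝ) < k := by
    exact_mod_cast (by omega : 0 < k)
  have hk2 : (2 : ℝ) ≤ k := by
    exact_mod_cast hk
  have hratio : 0 ≤ 1 - 2 / (k : ℝ) := by
    rw [sub_nonneg, div_le_one hk0]
    exact hk2
  have hcard : ∀ i ≤ k, (S i).card ≤ i := by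
    intro i
    induction i with
    | zero => simp [hS0]
    | succ i ih =>
      intro hi
      have hle := Finset.card_le_card (hsubset (i + 1) (by omega) hi)
      have hinsert := Finset.card_insert_le (u (i + 1)) (S i)
      have hcard_prev := ih (by omega)
      simp only [Nat.add_sub_cancel] at hle
      omega
  have hdom : ∀ i ≤ k, ∀ R ⊆ S i, f R ≤ f (S i) := by
    intro i hi R hR
    rcases Nat.eq_zero_or_pos i with rfl | hpos
    · rw [hS0, Finset.subset_empty] at hR
      rw [hR, hS0]
    · exact hdelete i hpos hi R hR
  have hstep : ∀ i < k, (1 - 2 / (k : ℝ)) * f (S i) + f O / k ≤ f (S (i + 1)) := by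
    intro i hi
    have hmax := hgreedy (i + 1) (by omega) hi
    have hval := hvalue (i + 1) (by omega) hi
    simp only [Nat.add_sub_cancel] at hmax hval
    set d := f (insert (u (i + 1)) (S i)) - f (S i) with hd_def
    have hd : 0 ≤ d := by
      rcases (S i).eq_empty_or_nonempty with hempty | ⟨v, hv⟩
      · rw [hd_def, hempty]
        exact sub_nonneg.mpr (Finset.symmetric_submodular_empty_le hsym hsubmod _)
      · simpa [Finset.insert_eq_of_mem hv] using hmax v
    have hgain := Finset.submodular_union_sub_le_card_mul hsubmod hd hmax O
    have hcard_mul : (O.card : ℝ) * d ≤ k * d :=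
      mul_le_mul_of_nonneg_right (by exact_mod_cast hO) hd
    have hloss :=
      Finset.symmetric_submodular_le_union_add_sdiff hnonneg hsym hsubmod O (S i)
    have hsdiff := hdom i hi.le (S i \ O) Finset.sdiff_subset
    have hdiv : (f O - 2 * f (S i)) / k ≤ d := by
      rw [div_le_iff₀ hk0]
      linarith
    calc (1 - 2 / (k : ℝ)) * f (S i) + f O / k
        = f (S i) + (f O - 2 * f (S i)) / k := by ring
      _ ≤ f (S (i + 1)) := by linarith
  have hbound : ∀ i ≤ k, (1 / 2) * (1 - (1 - 2 / (k : ℝ)) ^ i) * f O ≤ f (S i) := by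
    intro i
    induction i with
    | zero => simpa using hnonneg (S 0)
    | succ i ih =>
      intro hi
      have hprev := mul_le_mul_of_nonneg_left (ih (by omega)) hratio
      calc (1 / 2) * (1 - (1 - 2 / (k : ℝ)) ^ (i + 1)) * f O
          = (1 - 2 / (k : ℝ)) * ((1 / 2) * (1 - (1 - 2 / (k : ℝ)) ^ i) * f O) + f O / k := by
            ring
        _ ≤ f (S (i + 1)) := by linarith [hstep i hi]
  refine ⟨hcard k le_rfl, hbound k le_rfl, mul_le_mul_of_nonneg_right ?_ (hnonneg O)⟩
  linarith [Real.one_sub_div_pow_le_exp_neg hk2]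
end

section
/- Let k ≥ 1 be an integer, α ∈ (0, 1] with 2α ≤ k, F ≥ 0 a real number, and (x_i)_{i=0}^{k} a sequence of real numbers with x₀ ≥ 0 such that x_i − x_{i−1} ≥ (α/k)·(F − 2·x_{i−1}) for every i ∈ {1,…,k}. Then x_k ≥ (1/2)·(1 − (1 − 2α/k)^k)·F ≥ (1/2)·(1 − e^{−2α})·F. -/
/-- Let `k ≥ 1` be an integer, `α ∈ (0, 1]` with `2α ≤ k`, `F ≥ 0` a
real, and `(x_i)_{i=0}^k` a real sequence with `x₀ ≥ 0` satisfying
`x_i − x_{i−1} ≥ (α/k)·(F − 2·x_{i−1})` for `1 ≤ i ≤ k`. Then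
`x_k ≥ (1/2)·(1 − (1 − 2α/k)^k)·F ≥ (1/2)·(1 − e^{−2α})·F`. -/
theorem sample_greedy_recursion
    (k : ℕ) (hk : 1 ≤ k) (α : ℝ) (hα0 : 0 < α) (hα1 : α ≤ 1) (hαk : 2 * α ≤ (k : ℝ))
    (F : ℝ) (hF : 0 ≤ F)
    (x : ℕ → ℝ) (hx0 : 0 ≤ x 0)
    (hrec : ∀ i, 1 ≤ i → i ≤ k → x i - x (i - 1) ≥ (α / (k : ℝ)) * (F - 2 * x (i - 1))) :
    x k ≥ (1 / 2) * (1 - (1 - 2 * α / (k : ℝ)) ^ k) * F ∧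
      (1 / 2) * (1 - (1 - 2 * α / (k : ℝ)) ^ k) * F ≥
        (1 / 2) * (1 - Real.exp (-2 * α)) * F := by
  have hk_pos : (0 : ℝ) < k := by exact_mod_cast hk
  have hq : 0 ≤ 1 - 2 * α / (k : ℝ) := sub_nonneg.2 ((div_le_one hk_pos).2 hαk)
  constructor
  · have hgap : F - 2 * x k ≤ (1 - 2 * α / (k : ℝ)) ^ k * (F - 2 * x 0) := by
      refine le_geom (u := fun i => F - 2 * x i) hq k fun i hi => ?_
      have hstep := hrec (i + 1) (Nat.le_add_left 1 i) hi
      rw [Nat.add_sub_cancel] at hstep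
      linear_combination 2 * hstep
    have hpow : 0 ≤ (1 - 2 * α / (k : ℝ)) ^ k * x 0 := mul_nonneg (pow_nonneg hq k) hx0
    linear_combination hgap / 2 + hpow
  · have hexp := Real.one_sub_div_pow_le_exp_neg hαk
    rw [← neg_mul] at hexp
    gcongr
end

section
/- Let f be a non-negative, symmetric, submodular set function on a finite ground set N, let k ≥ 1 be an integer, and let S ⊆ N with |S| = k satisfy f(R) ≤ f(S) for all R ⊆ S. Let O ⊆ N, let B ⊆ N \ S be a set with |B| = k such that Σ_{u∈B} f(u | S) ≥ Σ_{u∈O\S} f(u | S), and let g : B → S be a bijection. Then max_{u∈B} f((S ∪ {u}) \ {g(u)}) ≥ f(S) + (1/k)·(f(O) − 3·f(S)). -/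
/-- A submodular function gains at most the sum of the single-element marginals. -/
theorem submodular_union_sub_le_sum {N : Type*} [DecidableEq N] (f : Finset N → ℝ)
    (hsubmod : ∀ A B : Finset N, f (A ∪ B) + f (A ∩ B) ≤ f A + f B) (S T : Finset N) :
    f (S ∪ T) - f S ≤ ∑ u ∈ T, (f (insert u S) - f S) := by
  induction T using Finset.induction_on with
  | empty => simp
  | insert a T ha ih =>
    rw [Finset.sum_insert ha]
    have h := hsubmod (S ∪ T) (insert a S)
    have h1 : (S ∪ T) ∪ insert a S = S ∪ insert a T := by
      ext x; simp only [Finset.mem_union, Finset.mem_insert]; tauto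
    have h2 : (S ∪ T) ∩ insert a S = S := by
      ext x
      simp only [Finset.mem_union, Finset.mem_inter, Finset.mem_insert]
      constructor
      · rintro ⟨hS | hT, rfl | hS'⟩ <;> first | assumption | contradiction
      · exact fun hx => ⟨Or.inl hx, Or.inr hx⟩
    rw [h1, h2] at h
    linarith

/-- Single-round exchange inequality of the greedy matroid algorithm.
Let `f` be a non-negative, symmetric, submodular set function on a finite ground set `N`,
`k ≥ 1`, and `S ⊆ N` with `|S| = k` and `f R ≤ f S` for all `R ⊆ S`. Let `O ⊆ N`, let
`B ⊆ N \ S` with `|B| = k` and `Σ_{u∈B} f(u|S) ≥ Σ_{u∈O\S} f(u|S)`, and let `g : B → S`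
be a bijection. Then `max_{u∈B} f((S ∪ {u}) \ {g u}) ≥ f S + (1/k)·(f O − 3·f S)`. -/
theorem greedy_matroid_exchange_step
    {N : Type*} [Fintype N] [DecidableEq N] (f : Finset N → ℝ)
    (hnonneg : ∀ A : Finset N, 0 ≤ f A)
    (hsym : ∀ A : Finset N, f A = f Aᶜ)
    (hsubmod : ∀ A B : Finset N, f (A ∪ B) + f (A ∩ B) ≤ f A + f B)
    (k : ℕ) (hk : 1 ≤ k)
    (S : Finset N) (hScard : S.card = k) (hS : ∀ R ⊆ S, f R ≤ f S)
    (O : Finset N)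
    (B : Finset N) (hBS : Disjoint B S) (hBcard : B.card = k)
    (hBsum : ∑ u ∈ B, (f (insert u S) - f S) ≥ ∑ u ∈ O \ S, (f (insert u S) - f S))
    (g : N → N) (hg : Set.BijOn g (B : Set N) (S : Set N)) :
    ∃ u ∈ B, f ((insert u S).erase (g u)) ≥
      f S + (1 / (k : ℝ)) * (f O - 3 * f S) := by
  have hswap : ∀ u ∈ B, (f (insert u S) - f S) + (f (S.erase (g u)) - f S) ≤
      f ((insert u S).erase (g u)) - f S := by
    intro u hu
    have hgS : g u ∈ S := hg.mapsTo hu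
    have huS : u ∉ S := Finset.disjoint_left.mp hBS hu
    have h := hsubmod ((insert u S).erase (g u)) S
    have h1 : (insert u S).erase (g u) ∪ S = insert u S := by
      ext x
      simp only [Finset.mem_union, Finset.mem_erase, Finset.mem_insert]
      by_cases hx : x = g u
      · subst hx; simp [hgS]
      · tauto
    have h2 : (insert u S).erase (g u) ∩ S = S.erase (g u) := by
      ext x
      simp only [Finset.mem_inter, Finset.mem_erase, Finset.mem_insert]
      tauto
    rw [h1, h2] at h
    linarith
  have hremove : -f S ≤ ∑ u ∈ B, (f (S.erase (g u)) - f S) := by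
    have hreindex : ∑ u ∈ B, (f (S.erase (g u)) - f S) = ∑ v ∈ S, (f (S.erase v) - f S) :=
      Finset.sum_bij (fun u _ => g u) (fun u hu => hg.mapsTo hu)
        (fun u hu v hv h => hg.injOn hu hv h)
        (fun v hv => by
          obtain ⟨u, hu, rfl⟩ := hg.surjOn hv
          exact ⟨u, hu, rfl⟩)
        (fun _ _ => rfl)
    have h := submodular_union_sub_le_sum f hsubmod Sᶜ S
    have hcompl : ∀ v, f (insert v Sᶜ) = f (S.erase v) := fun v => by
      rw [hsym (S.erase v), Finset.compl_erase]
    simp only [hcompl, ← hsym S] at h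
    rw [hreindex]
    linarith [hnonneg (Sᶜ ∪ S)]
  have hadd : f (S ∪ O) - f S ≤ ∑ u ∈ B, (f (insert u S) - f S) := by
    have h := submodular_union_sub_le_sum f hsubmod S (O \ S)
    rw [Finset.union_sdiff_self_eq_union] at h
    linarith
  have hunion : f O ≤ f (S ∪ O) + f S := by
    have h := hsubmod (S ∪ O) (S \ O)ᶜ
    have hO : (S ∪ O) ∩ (S \ O)ᶜ = O := by
      ext x
      simp only [Finset.mem_inter, Finset.mem_union, Finset.mem_compl, Finset.mem_sdiff]
      tauto
    rw [hO, ← hsym] at h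
    linarith [hnonneg ((S ∪ O) ∪ (S \ O)ᶜ), hS (S \ O) Finset.sdiff_subset]
  have htotal : f O - 3 * f S ≤ ∑ u ∈ B, (f ((insert u S).erase (g u)) - f S) := by
    have h := Finset.sum_le_sum hswap
    rw [Finset.sum_add_distrib] at h
    linarith
  have hkpos : (0 : ℝ) < k := by exact_mod_cast hk
  have hB : B.Nonempty := Finset.card_pos.mp (by omega)
  have haverage : ∑ _u ∈ B, (1 / (k : ℝ)) * (f O - 3 * f S) ≤
      ∑ u ∈ B, (f ((insert u S).erase (g u)) - f S) := by
    rw [Finset.sum_const, hBcard, nsmul_eq_mul, ← mul_assoc, mul_one_div_cancel hkpos.ne',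
      one_mul]
    exact htotal
  obtain ⟨u, hu, h⟩ := Finset.exists_le_of_sum_le hB haverage
  exact ⟨u, hu, by linarith⟩
end

section
/- Let f be a non-negative, symmetric, submodular set function on a finite ground set N, and let S ⊆ N satisfy f(R) ≤ f(S) for all R ⊆ S and f(j | S) ≤ 0 for every j ∈ N \ S. Then f(S) ≥ f(O)/2 for every set O ⊆ N. -/
/-- If a submodular function does not increase when any single element is added to `S`, then it
does not increase when any set is added to `S`. -/
lemma union_le_of_insert_le {N : Type*} [DecidableEq N] {f : Finset N → ℝ}
    (hsubmod : ∀ A B : Finset N, f (A ∪ B) + f (A ∩ B) ≤ f A + f B)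
    {S : Finset N} (hmarg : ∀ j ∉ S, f (insert j S) ≤ f S) (T : Finset N) :
    f (S ∪ T) ≤ f S := by
  induction T using Finset.induction_on with
  | empty => simp
  | insert j T _ ih =>
    by_cases hj : j ∈ S ∪ T
    · rwa [Finset.union_insert, Finset.insert_eq_of_mem hj]
    · have hjS : j ∉ S := fun h => hj (Finset.mem_union_left T h)
      have hunion : (S ∪ T) ∪ insert j S = S ∪ insert j T := by
        ext x
        simp only [Finset.mem_union, Finset.mem_insert]
        tauto
      have hinter : (S ∪ T) ∩ insert j S = S := by
        rw [Finset.inter_insert_of_notMem hj]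
        exact Finset.inter_eq_right.mpr Finset.subset_union_left
      have h := hsubmod (S ∪ T) (insert j S)
      rw [hunion, hinter] at h
      linarith [hmarg j hjS]

/-- Let `f` be a non-negative, symmetric, submodular set function on a
finite ground set `N`, and let `S ⊆ N` satisfy `f R ≤ f S` for all `R ⊆ S` and
`f(j | S) ≤ 0` for every `j ∈ N \ S`. Then `f S ≥ f O / 2` for every set `O ⊆ N`. -/
theorem local_maximum_half_optimal
    {N : Type*} [Fintype N] [DecidableEq N] (f : Finset N → ℝ)
    (hnonneg : ∀ A : Finset N, 0 ≤ f A)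
    (hsym : ∀ A : Finset N, f A = f Aᶜ)
    (hsubmod : ∀ A B : Finset N, f (A ∪ B) + f (A ∩ B) ≤ f A + f B)
    (S : Finset N) (hS : ∀ R ⊆ S, f R ≤ f S)
    (hmarg : ∀ j ∉ S, f (insert j S) - f S ≤ 0) :
    ∀ O : Finset N, f S ≥ f O / 2 := by
  intro O
  have hinter := hS (S ∩ O) Finset.inter_subset_left
  have hunion := union_le_of_insert_le hsubmod (fun j hj => sub_nonpos.mp (hmarg j hj)) Oᶜ
  have hcompl : (S ∪ Oᶜ)ᶜ = O \ S := by
    ext x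
    simp only [Finset.mem_compl, Finset.mem_union, Finset.mem_sdiff]
    tauto
  rw [hsym (S ∪ Oᶜ), hcompl] at hunion
  have hsplit : (S ∩ O) ∪ (O \ S) = O := by
    ext x
    simp only [Finset.mem_union, Finset.mem_inter, Finset.mem_sdiff]
    tauto
  have h := hsubmod (S ∩ O) (O \ S)
  rw [hsplit] at h
  linarith [hnonneg ((S ∩ O) ∩ (O \ S))]
end

section
/- Let ε ∈ (0, 1), m ≥ 1 an integer, and W a real number with W ≥ max{ln m, 1}/ε². Let F > 0, and let a₀ ≤ a₁ ≤ … ≤ a_t be real numbers with a₀ ≥ 0 and F > 2·a_t. Let β₀, β₁, …, β_t be positive reals with β₀ = m, β_t ≥ e^{ε(W−1)}, and β_r ≤ β_{r−1}·exp((εW + ε²W)·(a_r − a_{r−1})/(F − 2·a_{r−1})) for every r ∈ {1,…,t}. Then a_t ≥ (1/2)·(1 − e^{−2(1−3ε)})·F. -/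
/-- One step of the expand recursion: a relative decrease from `F - 2x` to `F - 2y` is at most
half the corresponding decrease of the logarithm. -/
lemma div_sub_two_mul_le_half_log {F x y : ℝ} (hx : 0 < F - 2 * x) (hy : 0 < F - 2 * y) :
    (y - x) / (F - 2 * x) ≤ (1 / 2) * (Real.log (F - 2 * x) - Real.log (F - 2 * y)) := by
  have h := Real.log_le_sub_one_of_pos (div_pos hy hx)
  rw [Real.log_div hy.ne' hx.ne'] at h
  have h' : (y - x) / (F - 2 * x) = (1 / 2) * (1 - (F - 2 * y) / (F - 2 * x)) := by
    rw [one_sub_div hx.ne', mul_div_assoc']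
    congr 1
    ring
  linarith

/-- A sequence growing by factors `exp (c * (a r - a (r - 1)) / (F - 2 * a (r - 1)))` has its
logarithm bounded by the telescoped half-logarithm. -/
lemma log_le_of_multiplicative_recursion {c F : ℝ} (hc : 0 ≤ c) {t : ℕ} {a β : ℕ → ℝ}
    (haF : ∀ r ≤ t, 0 < F - 2 * a r) (hβpos : ∀ r ≤ t, 0 < β r)
    (hβrec : ∀ r, 1 ≤ r → r ≤ t →
      β r ≤ β (r - 1) * Real.exp (c * (a r - a (r - 1)) / (F - 2 * a (r - 1)))) :
    Real.log (β t) ≤ Real.log (β 0) +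
      c * ((1 / 2) * (Real.log (F - 2 * a 0) - Real.log (F - 2 * a t))) := by
  induction t with
  | zero => simp
  | succ t ih =>
    have ih := ih (fun r hr => haF r (by omega)) (fun r hr => hβpos r (by omega))
      (fun r h hr => hβrec r h (by omega))
    have hrec := hβrec (t + 1) (by omega) le_rfl
    rw [Nat.add_sub_cancel] at hrec
    have hlog := Real.log_le_log (hβpos (t + 1) le_rfl) hrec
    rw [Real.log_mul (hβpos t (by omega)).ne' (Real.exp_pos _).ne', Real.log_exp,
      mul_div_assoc] at hlog
    have hstep := mul_le_mul_of_nonneg_left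
      (div_sub_two_mul_le_half_log (haF t (by omega)) (haF (t + 1) le_rfl)) hc
    linarith

/-- Analytic core of the analysis of the multiplicative-updates
algorithm for packing constraints of width `W`. Let `ε ∈ (0,1)`, `m ≥ 1` an integer, and
`W ≥ max{ln m, 1}/ε²`. Let `F > 0` and `a₀ ≤ a₁ ≤ … ≤ a_t` be reals with `a₀ ≥ 0` and
`F > 2·a_t`. Let `β₀, …, β_t` be positive reals with `β₀ = m`, `β_t ≥ e^{ε(W−1)}`, and
`β_r ≤ β_{r−1}·exp((εW + ε²W)·(a_r − a_{r−1})/(F − 2·a_{r−1}))` for every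
`r ∈ {1, …, t}`. Then `a_t ≥ (1/2)·(1 − e^{−2(1−3ε)})·F`. -/
theorem multiplicative_updates_core
    (ε : ℝ) (hε : ε ∈ Set.Ioo (0 : ℝ) 1)
    (m : ℕ) (hm : 1 ≤ m)
    (W : ℝ) (hW : W ≥ max (Real.log m) 1 / ε ^ 2)
    (F : ℝ) (hF : 0 < F)
    (t : ℕ) (a : ℕ → ℝ) (ha0 : 0 ≤ a 0)
    (hmono : ∀ r, 1 ≤ r → r ≤ t → a (r - 1) ≤ a r)
    (haF : F > 2 * a t)
    (β : ℕ → ℝ) (hβpos : ∀ r ≤ t, 0 < β r)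
    (hβ0 : β 0 = (m : ℝ)) (hβt : β t ≥ Real.exp (ε * (W - 1)))
    (hβrec : ∀ r, 1 ≤ r → r ≤ t →
      β r ≤ β (r - 1) *
        Real.exp ((ε * W + ε ^ 2 * W) * (a r - a (r - 1)) / (F - 2 * a (r - 1)))) :
    a t ≥ (1 / 2) * (1 - Real.exp (-2 * (1 - 3 * ε))) * F := by
  obtain ⟨hε0, hε1⟩ := hε
  have hε2 : 0 < ε ^ 2 := by positivity
  have hmax : max (Real.log m) 1 ≤ W * ε ^ 2 := (div_le_iff₀ hε2).mp hW
  have hlogm : Real.log m ≤ W * ε ^ 2 := (le_max_left _ _).trans hmax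
  have hWε : 1 ≤ W * ε ^ 2 := (le_max_right _ _).trans hmax
  have hWpos : 0 < W := by
    by_contra! h
    nlinarith
  have ha : ∀ r ≤ t, a r ≤ a t := fun r hr =>
    Nat.decreasingInduction' (P := fun k => a k ≤ a t)
      (fun k hk _ ih => (hmono (k + 1) (by omega) hk).trans ih) hr le_rfl
  have hc : 0 < ε * W + ε ^ 2 * W := by positivity
  have hd : 0 < F - 2 * a t := by linarith
  have hupper := log_le_of_multiplicative_recursion hc.le
    (fun r hr => by linarith [ha r hr]) hβpos hβrec
  have hlower := (Real.le_log_iff_exp_le (hβpos t le_rfl)).mpr hβt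
  have hlog0 : Real.log (F - 2 * a 0) ≤ Real.log F :=
    Real.log_le_log (by linarith [ha 0 (Nat.zero_le t)]) (by linarith)
  rw [hβ0] at hupper
  have hratio : (ε * W + ε ^ 2 * W) * (1 - 3 * ε) ≤ ε * (W - 1) - W * ε ^ 2 := by
    nlinarith [mul_le_mul_of_nonneg_left hWε hε0.le, mul_pos hWpos hε2,
      mul_pos (mul_pos hWpos hε2) hε0]
  have hhalf : 1 - 3 * ε ≤ (1 / 2) * (Real.log (F - 2 * a 0) - Real.log (F - 2 * a t)) :=
    le_of_mul_le_mul_left (by linarith) hc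
  have hle : F - 2 * a t ≤ Real.exp (-2 * (1 - 3 * ε)) * F := by
    rw [← Real.log_le_log_iff hd (by positivity),
      Real.log_mul (Real.exp_pos _).ne' hF.ne', Real.log_exp]
    linarith
  linarith
end
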